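/- Let n and k be even and let d be odd. Then the number of ballot sequences q of length n with exactly k entries equal to 1 satisfying ε(q) = 0 and δ(q) = d equals the number of ballot sequences q of length n with exactly k entries equal to 1 satisfying ε(q) = δ(q) − 1, δ(q) = d, and q_n = 1. -/

import Mathlib

open scoped Classical

/-- A ballot sequence of length `n`: entries (indexed so that `b i` is the entry in
position `i+1`) are `±1` and all partial sums are nonnegative. -/
def IsBallot {n : ℕ} (b : Fin n → ℤ) : Prop :=
  (∀ i, b i = 1 ∨ b i = -1) ∧
  ∀ j : Fin n, 0 ≤ ∑ i ∈ Finset.univ.filter (fun i => i ≤ j), b i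

/-- The number of entries equal to `1`. -/
def ones {n : ℕ} (b : Fin n → ℤ) : ℕ := (Finset.univ.filter (fun i => b i = 1)).card

/-- `eps b` is the smallest even (1-based) position `d` with `b_d = -b_{d+1}`,
and `0` if no such position exists. -/
noncomputable def eps {n : ℕ} (b : Fin n → ℤ) : ℕ :=
  sInf {d : ℕ | Even d ∧ 1 ≤ d ∧ ∃ h : d < n, b ⟨d - 1, by omega⟩ = -b ⟨d, h⟩}

/-- `delta b` is the greatest (1-based) position `d` with `b_d = 1` and `b_{d+1} = -1`. -/
noncomputable def delta {n : ℕ} (b : Fin n → ℤ) : ℕ :=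
  sSup {d : ℕ | 1 ≤ d ∧ ∃ h : d < n, b ⟨d - 1, by omega⟩ = 1 ∧ b ⟨d, h⟩ = -1}

/-- Extension of a finite sequence by zero, indexed from `0`. -/
noncomputable def zeroExtend {n : ℕ} (q : Fin n → ℤ) (i : ℕ) : ℤ :=
  if h : i < n then q ⟨i, h⟩ else 0

/-- The sum of the first `j` terms. -/
def partialSum (Q : ℕ → ℤ) (j : ℕ) : ℤ := ∑ i ∈ Finset.range j, Q i

/-- Change the signs of the terms at `a` and `b`. -/
def flipAt (a b : ℕ) (Q : ℕ → ℤ) (i : ℕ) : ℤ := if i = a ∨ i = b then -Q i else Q i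

/-- On `[d, n)`, the sequence is `-1` before `u` and `1` from `u` on. -/
def HasTail (n d u : ℕ) (Q : ℕ → ℤ) : Prop :=
  ∀ i, d ≤ i → i < n → Q i = if i < u then -1 else 1

/-- `Q` restricts to a ballot sequence of length `n` with `k` ones whose last descent is at `d`. -/
structure IsBallotWithDescent (n k d : ℕ) (Q : ℕ → ℤ) : Prop where
  sign : ∀ i, i < n → Q i = 1 ∨ Q i = -1
  nonneg : ∀ j, j ≤ n → 0 ≤ partialSum Q j
  total : partialSum Q n = 2 * k - n
  lt : d < n
  up : Q (d - 1) = 1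
  down : Q d = -1
  last : ∀ i, d < i → i < n → Q (i - 1) = 1 → Q i ≠ -1

/-- The terms before `m` are equal in pairs `(1, 2), (3, 4), …`. -/
def IsPaired (m : ℕ) (Q : ℕ → ℤ) : Prop :=
  ∀ i, Even i → 1 ≤ i → i < m → Q (i - 1) = Q i

theorem partialSum_succ (Q : ℕ → ℤ) (j : ℕ) : partialSum Q (j + 1) = partialSum Q j + Q j :=
  Finset.sum_range_succ _ _

theorem card_subtype_eq_of_rel {α β : Type*} {P : α → Prop} {P' : β → Prop} (R : α → β → Prop)
    (total : ∀ a, P a → ∃ b, P' b ∧ R a b) (surj : ∀ b, P' b → ∃ a, P a ∧ R a b)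
    (functional : ∀ a b b', R a b → R a b' → b = b')
    (inj : ∀ a a' b, R a b → R a' b → a = a') :
    Nat.card {a // P a} = Nat.card {b // P' b} := by
  choose f hf hR using total
  refine Nat.card_congr (Equiv.ofBijective (fun a => ⟨f a.1 a.2, hf a.1 a.2⟩) ⟨?_, ?_⟩)
  · rintro ⟨a, ha⟩ ⟨a', ha'⟩ h
    have h' : f a ha = f a' ha' := congrArg Subtype.val h
    exact Subtype.ext (inj a a' _ (hR a ha) (h' ▸ hR a' ha'))
  · rintro ⟨b, hb⟩
    obtain ⟨a, ha, hab⟩ := surj b hb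
    exact ⟨⟨a, ha⟩, Subtype.ext (functional a _ _ (hR a ha) hab)⟩

theorem zeroExtend_of_lt {n : ℕ} (q : Fin n → ℤ) {i : ℕ} (h : i < n) :
    zeroExtend q i = q ⟨i, h⟩ := dif_pos h

theorem zeroExtend_injective {n : ℕ} :
    Function.Injective (zeroExtend : (Fin n → ℤ) → ℕ → ℤ) := by
  intro q q' h
  funext i
  have := congrFun h i
  rwa [zeroExtend_of_lt q i.2, zeroExtend_of_lt q' i.2] at this

theorem exists_zeroExtend_eq_flipAt {n : ℕ} (q : Fin n → ℤ) (a b : ℕ) :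
    ∃ q' : Fin n → ℤ, zeroExtend q' = flipAt a b (zeroExtend q) := by
  refine ⟨fun i => flipAt a b (zeroExtend q) i, funext fun i => ?_⟩
  by_cases h : i < n <;> simp [flipAt, zeroExtend, h]

theorem flipAt_flipAt (a b : ℕ) (Q : ℕ → ℤ) : flipAt a b (flipAt a b Q) = Q := by
  funext i
  by_cases h : i = a ∨ i = b <;> simp [flipAt, h]

theorem partialSum_flipAt {a b : ℕ} (hab : a ≠ b) (Q : ℕ → ℤ) (j : ℕ) :
    partialSum (flipAt a b Q) j =
      partialSum Q j - (if a < j then 2 * Q a else 0) - (if b < j then 2 * Q b else 0) := by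
  induction j with
  | zero => simp [partialSum]
  | succ j ih =>
    rw [partialSum_succ, partialSum_succ, ih, flipAt]
    rcases eq_or_ne j a with rfl | ha
    · split_ifs <;> omega
    · rcases eq_or_ne j b with rfl | hb
      · split_ifs <;> omega
      · split_ifs <;> omega

theorem HasTail.unique {n d u v : ℕ} {Q : ℕ → ℤ} (hu : HasTail n d u Q) (hv : HasTail n d v Q)
    (hdu : d ≤ u) (hun : u ≤ n) (hdv : d ≤ v) (hvn : v ≤ n) : u = v := by
  rcases lt_trichotomy u v with h | h | h
  · have h1 := hu u hdu (by omega)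
    have h2 := hv u hdu (by omega)
    simp [h] at h1 h2
    omega
  · exact h
  · have h1 := hu v hdv (by omega)
    have h2 := hv v hdv (by omega)
    simp [h] at h1 h2
    omega

theorem IsBallotWithDescent.exists_hasTail {n k d : ℕ} {Q : ℕ → ℤ}
    (h : IsBallotWithDescent n k d Q) : ∃ u, d < u ∧ u ≤ n ∧ HasTail n d u Q := by
  have hex : ∃ u, d ≤ u ∧ (u < n → Q u = 1) := ⟨n, h.lt.le, by omega⟩
  obtain ⟨hdu, hu⟩ := Nat.find_spec hex
  have hmin : ∀ m, m < Nat.find hex → d ≤ m → m < n ∧ Q m ≠ 1 := by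
    intro m hm hdm
    have := Nat.find_min hex hm
    grind
  have hun : Nat.find hex ≤ n := Nat.find_min' hex ⟨h.lt.le, by omega⟩
  generalize Nat.find hex = u at *
  have hne : d ≠ u := by
    rintro rfl
    have := hu h.lt
    have := h.down
    omega
  refine ⟨u, by omega, hun, fun i hdi hin => ?_⟩
  split_ifs with hiu
  · exact (h.sign i hin).resolve_left (hmin i hiu hdi).2
  · push Not at hiu
    induction i, hiu using Nat.le_induction with
    | base => exact hu hin
    | succ i hui ih =>
      have h1 := ih (by omega) (by omega)
      exact (h.sign _ hin).resolve_right (h.last (i + 1) (by omega) hin h1)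

theorem IsPaired.partialSum_emod {m : ℕ} {Q : ℕ → ℤ} (h : IsPaired m Q)
    (h0 : Q 0 = 1) (hs : ∀ i, i < m → Q i = 1 ∨ Q i = -1) (j : ℕ) (hj : 2 * j < m) :
    partialSum Q (2 * j + 1) % 4 = (2 * j + 1) % 4 := by
  induction j with
  | zero => simp [partialSum, h0]
  | succ j ih =>
    have h1 := h (2 * (j + 1)) (by simp) (by omega) hj
    have h2 := hs (2 * (j + 1)) hj
    have h3 := ih (by omega)
    rw [partialSum_succ, show 2 * (j + 1) = 2 * j + 1 + 1 by ring, partialSum_succ]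
    rw [show 2 * (j + 1) = 2 * j + 1 + 1 by ring, Nat.add_sub_cancel] at h1
    rw [show 2 * (j + 1) = 2 * j + 1 + 1 by ring] at h2
    push_cast
    omega

theorem IsBallotWithDescent.zero_eq_one {n k d : ℕ} {Q : ℕ → ℤ}
    (h : IsBallotWithDescent n k d Q) : Q 0 = 1 := by
  have h1 := h.nonneg 1 (by have := h.lt; omega)
  have h2 := h.sign 0 (by have := h.lt; omega)
  simp [partialSum] at h1
  omega

theorem IsBallotWithDescent.last_eq_one {n k d : ℕ} {Q : ℕ → ℤ} (hn : Even n) (hk : Even k)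
    (h : IsBallotWithDescent n k d Q) (hp : IsPaired n Q) : Q (n - 1) = 1 := by
  have hlt := h.lt
  obtain ⟨m, rfl⟩ := hn
  obtain ⟨l, rfl⟩ := hk
  obtain ⟨m, rfl⟩ : ∃ m', m = m' + 1 := ⟨m - 1, by omega⟩
  have h1 := hp.partialSum_emod h.zero_eq_one h.sign m (by omega)
  have h2 := h.total
  have h3 := h.sign (2 * m + 1) (by omega)
  rw [show m + 1 + (m + 1) = 2 * m + 1 + 1 by ring, partialSum_succ] at h2
  rw [show m + 1 + (m + 1) - 1 = 2 * m + 1 by omega]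
  push_cast at h2
  omega

theorem HasTail.partialSum_before {n d u : ℕ} {Q : ℕ → ℤ} (h : HasTail n d u Q) (hun : u ≤ n)
    (j : ℕ) (hj : d + j ≤ u) : partialSum Q (d + j) = partialSum Q d - j := by
  induction j with
  | zero => simp
  | succ j ih =>
    have h1 := h (d + j) (by omega) (by omega)
    rw [if_pos (by omega)] at h1
    rw [← add_assoc, partialSum_succ, ih (by omega), h1]
    push_cast
    ring

theorem HasTail.partialSum_after {n d u : ℕ} {Q : ℕ → ℤ} (h : HasTail n d u Q) (hdu : d ≤ u)
    (j : ℕ) (hj : u + j ≤ n) : partialSum Q (u + j) = partialSum Q u + j := by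
  induction j with
  | zero => simp
  | succ j ih =>
    have h1 := h (u + j) (by omega) (by omega)
    rw [if_neg (by omega)] at h1
    rw [← add_assoc, partialSum_succ, ih (by omega), h1]
    push_cast
    ring

theorem flipAt_apply_of_lt {a b i : ℕ} (Q : ℕ → ℤ) (ha : i < a) (hb : i < b) :
    flipAt a b Q i = Q i := if_neg (by omega)

theorem IsBallotWithDescent.flipAt_of_isPaired {n k d : ℕ} {Q : ℕ → ℤ} (hn : Even n) (hk : Even k)
    (hd : Odd d) (hd3 : 3 ≤ d) (h : IsBallotWithDescent n k d Q) (hp : IsPaired n Q) :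
    ∃ u, d + 2 ≤ u ∧ u < n ∧ HasTail n d u Q ∧
      HasTail n d (u - 1) (flipAt (d - 2) (u - 1) Q) ∧
      IsBallotWithDescent n k d (flipAt (d - 2) (u - 1) Q) ∧
      IsPaired (d - 1) (flipAt (d - 2) (u - 1) Q) ∧
      flipAt (d - 2) (u - 1) Q (d - 2) = -1 ∧ flipAt (d - 2) (u - 1) Q (n - 1) = 1 := by
  obtain ⟨u, hdu, hun, ht⟩ := h.exists_hasTail
  have hlast := h.last_eq_one hn hk hp
  have hlt := h.lt
  have hun' : u < n := by
    by_contra hc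
    have := ht (n - 1) (by omega) (by omega)
    rw [if_pos (by omega)] at this
    omega
  have hu : Odd u := by
    by_contra hc
    have h1 := hp u (Nat.not_odd_iff_even.1 hc) (by omega) hun'
    have h2 := ht u (by omega) hun'
    have h3 := ht (u - 1) (by omega) (by omega)
    rw [if_neg (by omega)] at h2
    rw [if_pos (by omega)] at h3
    omega
  have hdu2 : d + 2 ≤ u := by
    obtain ⟨a, rfl⟩ := hd
    obtain ⟨b, rfl⟩ := hu
    omega
  have hQd : Q (d - 2) = 1 := by
    have := hp (d - 1) (by obtain ⟨a, rfl⟩ := hd; simp) (by omega) (by omega)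
    rw [show d - 1 - 1 = d - 2 by omega, h.up] at this
    exact this
  have hQu : Q (u - 1) = -1 := by
    have := ht (u - 1) (by omega) (by omega)
    rwa [if_pos (by omega)] at this
  have ht' : HasTail n d (u - 1) (flipAt (d - 2) (u - 1) Q) := by
    intro i hdi hin
    have h1 := ht i hdi hin
    rw [flipAt]
    split_ifs at h1 ⊢ <;> omega
  have hsum := partialSum_flipAt (show d - 2 ≠ u - 1 by omega) Q
  rw [hQd, hQu] at hsum
  have hlo : ∀ j, d ≤ j → j < u → 2 ≤ partialSum Q j := by
    intro j hdj hju
    have h1 := ht.partialSum_before hun (j - d) (by omega)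
    have h2 := ht.partialSum_before hun (u - d) (by omega)
    rw [Nat.add_sub_cancel' (by omega)] at h1 h2
    have h3 := h.nonneg u hun
    obtain ⟨b, rfl⟩ := hu
    have h4 := hp.partialSum_emod h.zero_eq_one h.sign b (by omega)
    omega
  have hmid : 2 ≤ partialSum Q (d - 1) := by
    obtain ⟨a, rfl⟩ := hd
    obtain ⟨a, rfl⟩ : ∃ a', a = a' + 1 := ⟨a - 1, by omega⟩
    have h1 := hp.partialSum_emod h.zero_eq_one h.sign a (by omega)
    have h2 := h.nonneg (2 * a + 1) (by omega)
    rw [show 2 * (a + 1) + 1 - 1 = 2 * a + 1 + 1 by omega, partialSum_succ]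
    rw [show 2 * (a + 1) + 1 - 2 = 2 * a + 1 by omega] at hQd
    omega
  refine ⟨u, hdu2, hun', ht, ht', ⟨?_, ?_, ?_, hlt, ?_, ?_, ?_⟩, ?_, ?_, ?_⟩
  · intro i hi
    have := h.sign i hi
    rw [flipAt]
    split_ifs <;> omega
  · intro j hj
    rw [hsum]
    have h1 := h.nonneg j hj
    have h2 := hlo j
    rcases eq_or_ne j (d - 1) with rfl | hne
    · split_ifs <;> omega
    · split_ifs <;> omega
  · rw [hsum, if_pos (by omega), if_pos (by omega), h.total]
    ring
  · rw [flipAt, if_neg (by omega), h.up]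
  · rw [ht' d le_rfl hlt, if_pos (by omega)]
  · intro i hdi hin h1
    rw [ht' (i - 1) (by omega) (by omega)] at h1
    rw [ht' i (by omega) hin]
    split_ifs at h1 ⊢ <;> omega
  · intro i he hi hid
    obtain ⟨a, rfl⟩ := hd
    obtain ⟨b, rfl⟩ := he
    rw [flipAt_apply_of_lt Q (by omega) (by omega), flipAt_apply_of_lt Q (by omega) (by omega)]
    exact hp _ (by simp) hi (by omega)
  · rw [flipAt, if_pos (Or.inl rfl), hQd]
  · rw [ht' (n - 1) (by omega) (by omega), if_neg (by omega)]

theorem IsBallotWithDescent.flipAt_of_last_eq_one {n k d : ℕ} {Q : ℕ → ℤ} (hn : Even n)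
    (hk : Even k) (hd : Odd d) (hd3 : 3 ≤ d) (h : IsBallotWithDescent n k d Q)
    (hp : IsPaired (d - 1) Q) (hQd : Q (d - 2) = -1) (hQn : Q (n - 1) = 1) :
    ∃ u, d + 2 ≤ u ∧ u < n ∧ HasTail n d (u - 1) Q ∧
      HasTail n d u (flipAt (d - 2) (u - 1) Q) ∧
      IsBallotWithDescent n k d (flipAt (d - 2) (u - 1) Q) ∧
      IsPaired n (flipAt (d - 2) (u - 1) Q) := by
  obtain ⟨t, hdt, htn, ht⟩ := h.exists_hasTail
  have hlt := h.lt
  have htn' : t < n := by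
    by_contra hc
    have := ht (n - 1) (by omega) (by omega)
    rw [if_pos (by omega)] at this
    omega
  have hte : Even t := by
    have hs := h.total
    have h1 := ht.partialSum_before htn (t - d) (by omega)
    have h2 := ht.partialSum_after hdt.le (n - t) (by omega)
    rw [Nat.add_sub_cancel' (by omega)] at h1 h2
    have hup := h.up
    obtain ⟨a, rfl⟩ := hd
    obtain ⟨a, rfl⟩ : ∃ a', a = a' + 1 := ⟨a - 1, by omega⟩
    have h3 := hp.partialSum_emod h.zero_eq_one (fun i hi => h.sign i (by omega)) a (by omega)
    rw [show 2 * (a + 1) + 1 = 2 * a + 1 + 1 + 1 by ring] at h1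
    rw [partialSum_succ, partialSum_succ] at h1
    rw [show 2 * (a + 1) + 1 - 2 = 2 * a + 1 by omega] at hQd
    rw [show 2 * (a + 1) + 1 - 1 = 2 * a + 2 by omega] at hup
    rw [Nat.even_iff] at hn hk ⊢
    omega
  have htn2 : t + 1 < n := by
    rw [Nat.even_iff] at hn hte
    omega
  have hQt : Q t = 1 := by
    have := ht t (by omega) (by omega)
    rwa [if_neg (by omega)] at this
  have ht' : HasTail n d (t + 1) (flipAt (d - 2) t Q) := by
    intro i hdi hin
    have h1 := ht i hdi hin
    rw [flipAt]
    split_ifs at h1 ⊢ <;> omega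
  have hsum := partialSum_flipAt (show d - 2 ≠ t by omega) Q
  rw [hQd, hQt] at hsum
  refine ⟨t + 1, by omega, htn2, ht, ht', ⟨?_, ?_, ?_, hlt, ?_, ?_, ?_⟩, ?_⟩ <;>
    rw [Nat.add_sub_cancel]
  · intro i hi
    have := h.sign i hi
    rw [flipAt]
    split_ifs <;> omega
  · intro j hj
    rw [hsum]
    have h1 := h.nonneg j hj
    split_ifs <;> omega
  · rw [hsum, if_pos (by omega), if_pos (by omega), h.total]
    ring
  · rw [flipAt, if_neg (by omega), h.up]
  · rw [ht' d le_rfl hlt, if_pos (by omega)]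
  · intro i hdi hin h1
    rw [ht' (i - 1) (by omega) (by omega)] at h1
    rw [ht' i (by omega) hin]
    split_ifs at h1 ⊢ <;> omega
  · intro i he hi hin
    rw [Nat.odd_iff] at hd
    rw [Nat.even_iff] at hte
    have he' := Nat.even_iff.1 he
    rcases lt_trichotomy i (d - 1) with hid | rfl | hid
    · rw [flipAt_apply_of_lt Q (by omega) (by omega),
        flipAt_apply_of_lt Q (by omega) (by omega)]
      exact hp _ he hi hid
    · rw [flipAt, flipAt, if_pos (by omega), if_neg (by omega), h.up,
        show d - 1 - 1 = d - 2 by omega, hQd]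
      rfl
    · rw [ht' (i - 1) (by omega) (by omega), ht' i (by omega) hin]
      split_ifs <;> omega

theorem sum_filter_le_eq_partialSum {n : ℕ} (q : Fin n → ℤ) (j : Fin n) :
    ∑ i ∈ Finset.univ.filter (fun i => i ≤ j), q i = partialSum (zeroExtend q) (j + 1) := by
  rw [partialSum, ← Finset.sum_subset (s₁ := (Finset.univ.filter (fun i => i ≤ j)).map
    Fin.valEmbedding), Finset.sum_map]
  · exact Finset.sum_congr rfl fun i _ => (zeroExtend_of_lt q i.2).symm
  · intro i hi
    simp only [Finset.mem_map, Finset.mem_filter, Finset.mem_univ, true_and,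
      Fin.valEmbedding_apply] at hi
    obtain ⟨a, ha, rfl⟩ := hi
    exact Finset.mem_range.2 (Nat.lt_succ_of_le ha)
  · intro i hi hni
    exfalso
    have hi' := Finset.mem_range.1 hi
    refine hni (Finset.mem_map.2 ⟨⟨i, by omega⟩, ?_, rfl⟩)
    simp only [Finset.mem_filter, Finset.mem_univ, true_and, Fin.le_def]
    omega

theorem partialSum_zeroExtend {n : ℕ} (q : Fin n → ℤ) (hq : ∀ i, q i = 1 ∨ q i = -1) :
    partialSum (zeroExtend q) n = 2 * ones q - n := by
  have h1 : partialSum (zeroExtend q) n = ∑ i, q i := by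
    rw [partialSum, Finset.sum_range]
    exact Finset.sum_congr rfl fun i _ => zeroExtend_of_lt q i.2
  have h2 : ∀ i, q i = 2 * (if q i = 1 then 1 else 0) - 1 := by
    intro i
    rcases hq i with h | h <;> simp [h]
  rw [h1, Finset.sum_congr rfl fun i _ => h2 i, Finset.sum_sub_distrib, ← Finset.mul_sum,
    Finset.sum_boole]
  simp [ones]

theorem delta_eq_iff {n d : ℕ} (q : Fin n → ℤ) (hd : 1 ≤ d) :
    delta q = d ↔ d < n ∧ zeroExtend q (d - 1) = 1 ∧ zeroExtend q d = -1 ∧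
      ∀ i, d < i → i < n → zeroExtend q (i - 1) = 1 → zeroExtend q i ≠ -1 := by
  have hmem : {d : ℕ | 1 ≤ d ∧ ∃ h : d < n, q ⟨d - 1, by omega⟩ = 1 ∧ q ⟨d, h⟩ = -1} =
      {d : ℕ | 1 ≤ d ∧ d < n ∧ zeroExtend q (d - 1) = 1 ∧ zeroExtend q d = -1} := by
    ext i
    constructor
    · rintro ⟨h1, h2, h3, h4⟩
      exact ⟨h1, h2, by rwa [zeroExtend_of_lt q], by rwa [zeroExtend_of_lt q]⟩
    · rintro ⟨h1, h2, h3, h4⟩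
      rw [zeroExtend_of_lt q (by omega)] at h3 h4
      exact ⟨h1, h2, h3, h4⟩
  rw [delta, hmem]
  have hbdd : BddAbove {d : ℕ | 1 ≤ d ∧ d < n ∧ zeroExtend q (d - 1) = 1 ∧
      zeroExtend q d = -1} := ⟨n, fun i hi => hi.2.1.le⟩
  constructor
  · intro h
    have hne : {d : ℕ | 1 ≤ d ∧ d < n ∧ zeroExtend q (d - 1) = 1 ∧
        zeroExtend q d = -1}.Nonempty := by
      by_contra hc
      rw [Set.not_nonempty_iff_eq_empty.1 hc] at h
      simp at h
      omega
    have h1 := Nat.sSup_mem hne hbdd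
    rw [h] at h1
    refine ⟨h1.2.1, h1.2.2.1, h1.2.2.2, fun i hdi hin h2 h3 => ?_⟩
    have := le_csSup hbdd (show i ∈ _ from ⟨by omega, hin, h2, h3⟩)
    omega
  · rintro ⟨h1, h2, h3, h4⟩
    refine IsGreatest.csSup_eq ⟨⟨hd, h1, h2, h3⟩, fun i hi => ?_⟩
    by_contra hc
    exact h4 i (by omega) hi.2.1 hi.2.2.1 hi.2.2.2

theorem isBallot_and_ones_and_delta_iff {n k d : ℕ} (q : Fin n → ℤ) (hd : 1 ≤ d) :
    (IsBallot q ∧ ones q = k ∧ delta q = d) ↔ IsBallotWithDescent n k d (zeroExtend q) := by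
  rw [delta_eq_iff q hd]
  constructor
  · rintro ⟨⟨hs, hb⟩, rfl, h1, h2, h3, h4⟩
    refine ⟨fun i hi => ?_, fun j hj => ?_, partialSum_zeroExtend q hs, h1, h2, h3, h4⟩
    · rw [zeroExtend_of_lt q hi]
      exact hs _
    · rcases j with _ | j
      · simp [partialSum]
      · have := hb ⟨j, hj⟩
        rwa [sum_filter_le_eq_partialSum] at this
  · intro h
    have hs : ∀ i, q i = 1 ∨ q i = -1 := fun i => by
      have := h.sign i i.2
      rwa [zeroExtend_of_lt q i.2] at this
    refine ⟨⟨hs, fun j => ?_⟩, ?_, h.lt, h.up, h.down, h.last⟩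
    · rw [sum_filter_le_eq_partialSum]
      exact h.nonneg _ j.2
    · have h1 := partialSum_zeroExtend q hs
      rw [h.total] at h1
      omega

theorem eps_eq_sInf {n : ℕ} (q : Fin n → ℤ) :
    eps q = sInf {d : ℕ | Even d ∧ 1 ≤ d ∧ d < n ∧ zeroExtend q (d - 1) = -zeroExtend q d} := by
  rw [eps]
  congr 1
  ext i
  constructor
  · rintro ⟨h1, h2, h3, h4⟩
    exact ⟨h1, h2, h3, by rwa [zeroExtend_of_lt q, zeroExtend_of_lt q]⟩
  · rintro ⟨h1, h2, h3, h4⟩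
    rw [zeroExtend_of_lt q (by omega), zeroExtend_of_lt q h3] at h4
    exact ⟨h1, h2, h3, h4⟩

theorem eps_eq_zero_iff {n : ℕ} (q : Fin n → ℤ)
    (hs : ∀ i, i < n → zeroExtend q i = 1 ∨ zeroExtend q i = -1) :
    eps q = 0 ↔ IsPaired n (zeroExtend q) := by
  rw [eps_eq_sInf, Nat.sInf_eq_zero]
  constructor
  · rintro (h | h) i he hi hin
    · exact absurd h.2.1 (by omega)
    · have h1 : i ∉ (∅ : Set ℕ) := id
      rw [← h] at h1
      have h2 : zeroExtend q (i - 1) ≠ -zeroExtend q i := fun h3 => h1 ⟨he, hi, hin, h3⟩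
      have := hs i hin
      have := hs (i - 1) (by omega)
      omega
  · intro h
    refine Or.inr (Set.eq_empty_of_forall_notMem ?_)
    rintro i ⟨he, hi, hin, h1⟩
    have := h i he hi hin
    have := hs i hin
    omega

theorem eps_eq_iff {n m : ℕ} (q : Fin n → ℤ) (hm : 1 ≤ m) (hme : Even m) (hmn : m < n)
    (hs : ∀ i, i < n → zeroExtend q i = 1 ∨ zeroExtend q i = -1) :
    eps q = m ↔ IsPaired m (zeroExtend q) ∧ zeroExtend q (m - 1) = -zeroExtend q m := by
  rw [eps_eq_sInf]
  constructor
  · intro h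
    have h1 := Nat.sInf_mem (Nat.nonempty_of_pos_sInf (h.symm ▸ hm))
    rw [h] at h1
    refine ⟨fun i he hi him => ?_, h1.2.2.2⟩
    have h2 : i ∉ _ := Nat.notMem_of_lt_sInf (h.symm ▸ him)
    have h3 : zeroExtend q (i - 1) ≠ -zeroExtend q i := fun h3 => h2 ⟨he, hi, by omega, h3⟩
    have := hs i (by omega)
    have := hs (i - 1) (by omega)
    omega
  · rintro ⟨h1, h2⟩
    refine IsLeast.csInf_eq ⟨⟨hme, hm, hmn, h2⟩, ?_⟩
    rintro i ⟨he, hi, hin, h3⟩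
    by_contra hc
    have := h1 i he hi (by omega)
    have := hs i hin
    omega

theorem card_Astar_eq_card_Bstar_even (n k d : ℕ)
    (hn : Even n) (hk : Even k) (hd : Odd d) :
    Nat.card {q : Fin n → ℤ //
        IsBallot q ∧ ones q = k ∧ eps q = 0 ∧ delta q = d}
      =
    Nat.card {q : Fin n → ℤ //
        IsBallot q ∧ ones q = k ∧ eps q = delta q - 1 ∧ delta q = d ∧
        ∃ h : 0 < n, q ⟨n - 1, by omega⟩ = 1} := by
  have hd1 : 1 ≤ d := hd.pos
  have hA : ∀ q : Fin n → ℤ, (IsBallot q ∧ ones q = k ∧ eps q = 0 ∧ delta q = d) ↔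
      IsBallotWithDescent n k d (zeroExtend q) ∧ IsPaired n (zeroExtend q) := by
    intro q
    rw [← isBallot_and_ones_and_delta_iff q hd1]
    constructor
    · rintro ⟨h1, h2, h3, h4⟩
      have h5 := (isBallot_and_ones_and_delta_iff q hd1).1 ⟨h1, h2, h4⟩
      exact ⟨⟨h1, h2, h4⟩, (eps_eq_zero_iff q h5.sign).1 h3⟩
    · rintro ⟨h, h3⟩
      have h5 := (isBallot_and_ones_and_delta_iff q hd1).1 h
      exact ⟨h.1, h.2.1, (eps_eq_zero_iff q h5.sign).2 h3, h.2.2⟩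
  rcases (show d = 1 ∨ 3 ≤ d by rw [Nat.odd_iff] at hd; omega) with rfl | hd3
  · refine Nat.card_congr (Equiv.subtypeEquivRight fun q => ?_)
    constructor
    · intro h
      obtain ⟨h1, h2⟩ := (hA q).1 h
      have hlt := h1.lt
      refine ⟨h.1, h.2.1, by rw [h.2.2.1, h.2.2.2], h.2.2.2, by omega, ?_⟩
      have := h1.last_eq_one hn hk h2
      rwa [zeroExtend_of_lt q (by omega)] at this
    · rintro ⟨h1, h2, h3, h4, -⟩
      exact ⟨h1, h2, by rw [h3, h4], h4⟩
  have hB : ∀ q : Fin n → ℤ, (IsBallot q ∧ ones q = k ∧ eps q = delta q - 1 ∧ delta q = d ∧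
        ∃ h : 0 < n, q ⟨n - 1, by omega⟩ = 1) ↔
      IsBallotWithDescent n k d (zeroExtend q) ∧ IsPaired (d - 1) (zeroExtend q) ∧
        zeroExtend q (d - 2) = -1 ∧ zeroExtend q (n - 1) = 1 := by
    intro q
    have hde : Even (d - 1) := by
      obtain ⟨a, rfl⟩ := hd
      simp
    have heps : IsBallotWithDescent n k d (zeroExtend q) → (eps q = d - 1 ↔
        IsPaired (d - 1) (zeroExtend q) ∧ zeroExtend q (d - 2) = -1) := by
      intro h
      have := h.lt
      rw [eps_eq_iff q (by omega) hde (by omega) h.sign, h.up]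
      rfl
    rw [← isBallot_and_ones_and_delta_iff q hd1] at heps ⊢
    constructor
    · rintro ⟨h1, h2, h3, h4, h5, h6⟩
      rw [h4] at h3
      obtain ⟨h7, h8⟩ := (heps ⟨h1, h2, h4⟩).1 h3
      exact ⟨⟨h1, h2, h4⟩, h7, h8, by rwa [zeroExtend_of_lt q (by omega)]⟩
    · rintro ⟨h, h7, h8, h9⟩
      have hlt := ((isBallot_and_ones_and_delta_iff q hd1).1 h).lt
      rw [zeroExtend_of_lt q (by omega)] at h9
      exact ⟨h.1, h.2.1, by rw [h.2.2, (heps h).2 ⟨h7, h8⟩], h.2.2, by omega, h9⟩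
  simp only [hA, hB]
  refine card_subtype_eq_of_rel (fun q q' => ∃ u, d + 2 ≤ u ∧ u < n ∧
    HasTail n d u (zeroExtend q) ∧ HasTail n d (u - 1) (zeroExtend q') ∧
    zeroExtend q' = flipAt (d - 2) (u - 1) (zeroExtend q)) ?_ ?_ ?_ ?_
  · rintro q ⟨h, hp⟩
    obtain ⟨u, h1, h2, h3, h4, h5, h6, h7, h8⟩ := h.flipAt_of_isPaired hn hk hd hd3 hp
    obtain ⟨q', hq'⟩ := exists_zeroExtend_eq_flipAt q (d - 2) (u - 1)
    rw [← hq'] at h4 h5 h6 h7 h8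
    exact ⟨q', ⟨h5, h6, h7, h8⟩, u, h1, h2, h3, h4, hq'⟩
  · rintro q ⟨h, hp, hQd, hQn⟩
    obtain ⟨u, h1, h2, h3, h4, h5, h6⟩ := h.flipAt_of_last_eq_one hn hk hd hd3 hp hQd hQn
    obtain ⟨q', hq'⟩ := exists_zeroExtend_eq_flipAt q (d - 2) (u - 1)
    rw [← hq'] at h4 h5 h6
    exact ⟨q', ⟨h5, h6⟩, u, h1, h2, h4, h3, by rw [hq', flipAt_flipAt]⟩
  · rintro q q₁ q₂ ⟨u, h1, h2, h3, -, h5⟩ ⟨v, g1, g2, g3, -, g5⟩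
    obtain rfl : u = v := h3.unique g3 (by omega) (by omega) (by omega) (by omega)
    exact zeroExtend_injective (h5.trans g5.symm)
  · rintro q₁ q₂ q ⟨u, h1, h2, -, h4, h5⟩ ⟨v, g1, g2, -, g4, g5⟩
    have huv : u - 1 = v - 1 := h4.unique g4 (by omega) (by omega) (by omega) (by omega)
    rw [← huv] at g5
    refine zeroExtend_injective ?_
    rw [← flipAt_flipAt (d - 2) (u - 1) (zeroExtend q₁), ← h5, g5, flipAt_flipAt]
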